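/- Fix m ≥ 1 and let F, Fₙ : ℂ^m → ℂ^m (n ∈ ℕ) be holomorphic (complex analytic) maps such that Fₙ → F uniformly on every compact subset of ℂ^m. Assume F(0) = 0 and that the Fréchet derivative DF(0) : ℂ^m → ℂ^m is a linear isomorphism (equivalently, the complex Jacobian determinant of F at 0 is nonzero). Then for every δ > 0 there exists N ∈ ℕ such that for all n ≥ N there is a point xₙ ∈ ℂ^m with ‖xₙ‖ ≤ δ and Fₙ(xₙ) = 0. In particular, 0 lies in the image Fₙ(B₀) of any fixed small ball B₀ centered at 0 for all sufficiently large n. -/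

import Mathlib

open Metric in
/-- Cauchy estimate: a holomorphic map bounded by `c * r / 2` on a ball of radius `2 * r` is
`c`-Lipschitz on the concentric closed ball of radius `r`. -/
theorem lipschitzOnWith_closedBall_of_norm_le {E F : Type*}
    [NormedAddCommGroup E] [NormedSpace ℂ E] [NormedAddCommGroup F] [NormedSpace ℂ F]
    {g : E → F} (hg : Differentiable ℂ g) {a : E} {r : ℝ} (hr : 0 < r) {c : NNReal}
    (hbound : ∀ x ∈ closedBall a (2 * r), ‖g x‖ ≤ c * r / 2) :
    LipschitzOnWith c g (closedBall a r) := by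
  refine (convex_closedBall a r).lipschitzOnWith_of_nnnorm_fderiv_le (𝕜 := ℂ)
    (fun x _ => hg x) fun x hx => ?_
  have hsub : closedBall x r ⊆ closedBall a (2 * r) :=
    closedBall_subset_closedBall' (by linarith [mem_closedBall.1 hx])
  have hmaps : Set.MapsTo g (ball x r) (closedBall (g x) (c * r)) := by
    intro y hy
    rw [mem_closedBall, dist_eq_norm]
    linarith [norm_sub_le (g y) (g x), hbound y (hsub (ball_subset_closedBall hy)),
      hbound x (hsub (mem_closedBall_self hr.le))]
  have h := Complex.norm_fderiv_le_div_of_mapsTo_ball hg.differentiableOn hmaps hr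
  rwa [mul_div_cancel_right₀ _ hr.ne'] at h

/-- if holomorphic maps `Fₙ : ℂ^m → ℂ^m` converge to `F` uniformly on
compact sets, `F 0 = 0` and `DF(0)` is a linear isomorphism, then for every `δ > 0`
and all large `n`, `Fₙ` has a zero `xₙ` with `‖xₙ‖ ≤ δ`. -/
theorem stmt4
    (m : ℕ) (hm : 1 ≤ m)
    (F : EuclideanSpace ℂ (Fin m) → EuclideanSpace ℂ (Fin m))
    (Fn : ℕ → EuclideanSpace ℂ (Fin m) → EuclideanSpace ℂ (Fin m))
    (hF : AnalyticOnNhd ℂ F Set.univ)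
    (hFn : ∀ n, AnalyticOnNhd ℂ (Fn n) Set.univ)
    (hconv : ∀ K : Set (EuclideanSpace ℂ (Fin m)), IsCompact K →
      TendstoUniformlyOn Fn F Filter.atTop K)
    (hF0 : F 0 = 0)
    (hDF : Function.Bijective (fderiv ℂ F 0)) :
    ∀ δ : ℝ, 0 < δ → ∃ N : ℕ, ∀ n ≥ N,
      ∃ x : EuclideanSpace ℂ (Fin m), ‖x‖ ≤ δ ∧ Fn n x = 0 := by
  intro δ hδ
  have hsurj : (fderiv ℂ F 0).range = ⊤ := LinearMap.range_eq_top.2 hDF.surjective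
  let R := (fderiv ℂ F 0).nonlinearRightInverseOfSurjective hsurj
  have hR : 0 < R.nnnorm :=
    (fderiv ℂ F 0).nonlinearRightInverseOfSurjective_nnnorm_pos hsurj
  let c : NNReal := R.nnnorm⁻¹ / 4
  have hc : 0 < c := by positivity
  have hRc : (R.nnnorm : ℝ)⁻¹ = 4 * c := by simp only [c]; push_cast; ring
  obtain ⟨s, hs, hFs⟩ :=
    (hF 0 (Set.mem_univ 0)).hasStrictFDerivAt.approximates_deriv_on_nhds (Or.inr hc)
  obtain ⟨ρ, hρ, hρs⟩ := Metric.nhds_basis_closedBall.mem_iff.1 hs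
  let r : ℝ := min ρ δ
  have hr : 0 < r := lt_min hρ hδ
  have hη : 0 < (c : ℝ) * r / 2 := by positivity
  obtain ⟨N, hN⟩ := Filter.eventually_atTop.1 <|
    Metric.tendstoUniformlyOn_iff.1
      (hconv _ (isCompact_closedBall (0 : EuclideanSpace ℂ (Fin m)) (2 * r))) _ hη
  refine ⟨N, fun n hn => ?_⟩
  have hclose : ∀ x ∈ Metric.closedBall (0 : EuclideanSpace ℂ (Fin m)) (2 * r),
      ‖(Fn n - F) x‖ ≤ c * r / 2 := fun x hx => by
    rw [Pi.sub_apply, ← dist_eq_norm, dist_comm]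
    exact (hN n hn x hx).le
  have hlip := lipschitzOnWith_closedBall_of_norm_le
    (fun x => ((hFn n x (Set.mem_univ x)).sub (hF x (Set.mem_univ x))).differentiableAt)
    hr hclose
  have happrox : ApproximatesLinearOn (Fn n) (fderiv ℂ F 0) (Metric.closedBall 0 r) (c + c) := by
    rw [ApproximatesLinearOn.approximatesLinearOn_iff_lipschitzOnWith]
    have hFlip := (hFs.mono_set
      ((Metric.closedBall_subset_closedBall (min_le_left ρ δ)).trans hρs)).lipschitzOnWith
    have hsum : LipschitzOnWith (c + c) ((Fn n - F) + (F - ⇑(fderiv ℂ F 0)))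
        (Metric.closedBall 0 r) := hlip.add hFlip
    rwa [sub_add_sub_cancel] at hsum
  have h0 : ‖Fn n 0‖ ≤ c * r / 2 := by
    simpa [hF0] using hclose 0 (Metric.mem_closedBall_self (by positivity))
  obtain ⟨x, hx, hx0⟩ := happrox.surjOn_closedBall_of_nonlinearRightInverse R hr.le subset_rfl
    (show (0 : EuclideanSpace ℂ (Fin m)) ∈ _ by
      rw [Metric.mem_closedBall, dist_zero_left, hRc]
      push_cast
      nlinarith [h0, hη])
  exact ⟨x, (mem_closedBall_zero_iff.1 hx).trans (min_le_right ρ δ), hx0⟩
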